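/- The real Banach space L¹([0,1]) (of equivalence classes of Lebesgue-integrable functions on [0,1] with the L¹ norm) has no besselian Schauder frame: there is no sequence ((a_n, b_n))_{n≥1} in L¹([0,1]) × (L¹([0,1]))* such that for every x the partial sums ∑_{j=1}^n b_j(x) a_j converge in norm to x and there is a constant A > 0 with ∑_{n=1}^∞ |b_n(x)| · |y(a_n)| ≤ A‖x‖‖y‖ for all x ∈ L¹([0,1]) and y ∈ (L¹([0,1]))*. -/

import Mathlib

open Filter Topology

/-- `((a n, b n))` is a Schauder frame of `X`: the partial sums `∑_{j<n} b j x • a j`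
converge in norm to `x` for every `x ∈ X`. -/
def IsSchauderFrame {X : Type*} [NormedAddCommGroup X] [NormedSpace ℝ X]
    (a : ℕ → X) (b : ℕ → X →L[ℝ] ℝ) : Prop :=
  ∀ x : X, Tendsto (fun n => ∑ j ∈ Finset.range n, b j x • a j) atTop (𝓝 x)

/-- `((a n, b n))` is a besselian pair of `X`: there is `A > 0` such that
`∑ |b n x| |y (a n)| ≤ A ‖x‖ ‖y‖` for all `x ∈ X`, `y ∈ X*`. -/
def IsBesselianPair {X : Type*} [NormedAddCommGroup X] [NormedSpace ℝ X]
    (a : ℕ → X) (b : ℕ → X →L[ℝ] ℝ) : Prop :=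
  ∃ A > (0 : ℝ), ∀ (x : X) (y : X →L[ℝ] ℝ),
    Summable (fun n => |b n x| * |y (a n)|) ∧
    ∑' n, |b n x| * |y (a n)| ≤ A * ‖x‖ * ‖y‖

/-- A besselian Schauder frame is a pair which is both a Schauder frame and a
besselian pair. -/
def IsBesselianSchauderFrame {X : Type*} [NormedAddCommGroup X] [NormedSpace ℝ X]
    (a : ℕ → X) (b : ℕ → X →L[ℝ] ℝ) : Prop :=
  IsSchauderFrame a b ∧ IsBesselianPair a b

open MeasureTheory

/-- Rademacher-type functions. -/
noncomputable def rad (n : ℕ) (x : ℝ) : ℝ := ((((-1 : ℤˣ) ^ ⌊(2:ℝ) ^ (n+1) * x⌋ : ℤˣ) : ℤ) : ℝ)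

lemma rad_eq (n : ℕ) (x : ℝ) : rad n x = 1 ∨ rad n x = -1 := by
  unfold rad
  rcases Int.units_eq_one_or ((-1 : ℤˣ) ^ ⌊(2:ℝ) ^ (n+1) * x⌋) with h | h <;> simp [h]

lemma rad_meas (n : ℕ) : Measurable (rad n) := by
  unfold rad
  have h1 : Measurable (fun x : ℝ => ⌊(2:ℝ) ^ (n+1) * x⌋) :=
    Int.measurable_floor.comp (measurable_const.mul measurable_id)
  have h2 : Measurable (fun k : ℤ => ((((-1 : ℤˣ) ^ k : ℤˣ) : ℤ) : ℝ)) := measurable_from_top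
  exact h2.comp h1

lemma rad_shift (n : ℕ) (x t : ℝ) (k : ℤ) (h : (2:ℝ) ^ (n+1) * t = k) :
    rad n (x + t) = (((-1 : ℤˣ) ^ k : ℤˣ) : ℤ) * rad n x := by
  unfold rad
  rw [mul_add, h, Int.floor_add_intCast, zpow_add]
  push_cast
  ring

lemma rad_periodic (n : ℕ) : Function.Periodic (rad n) 1 := by
  intro x
  rw [rad_shift n x 1 (2 ^ (n+1)) (by push_cast; ring)]
  have : Even ((2:ℤ) ^ (n+1)) := ⟨2^n, by ring⟩
  rw [this.neg_one_zpow]; simp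

lemma rad_orth_lt {m n : ℕ} (h : m < n) : ∫ x in (0:ℝ)..1, rad m x * rad n x = 0 := by
  obtain ⟨d, rfl⟩ := Nat.exists_eq_add_of_lt h
  set t : ℝ := ((2:ℝ) ^ (m+1))⁻¹ with ht
  have hp : Function.Periodic (fun x => rad m x * rad (m+d+1) x) 1 :=
    (rad_periodic m).mul (rad_periodic _)
  have hs : ∀ x, rad m (x + t) * rad (m+d+1) (x+t) = - (rad m x * rad (m+d+1) x) := by
    intro x
    rw [rad_shift m x t 1 (by rw [ht]; simp), rad_shift (m+d+1) x t (2^(d+1)) (by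
      rw [ht, mul_inv_eq_iff_eq_mul₀ (by positivity)]; push_cast; ring)]
    have : Even ((2:ℤ) ^ (d+1)) := ⟨2^d, by ring⟩
    rw [this.neg_one_zpow]; simp
  have h1 : ∫ x in (0:ℝ)..1, rad m (x+t) * rad (m+d+1) (x+t)
      = ∫ x in (0:ℝ)..1, rad m x * rad (m+d+1) x := by
    rw [intervalIntegral.integral_comp_add_right (fun x => rad m x * rad (m+d+1) x) t]
    have := hp.intervalIntegral_add_eq t 0
    rw [zero_add] at this ⊢
    rw [add_comm 1 t]; exact this
  simp_rw [hs] at h1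
  rw [intervalIntegral.integral_neg] at h1
  linarith

lemma rad_orth (m n : ℕ) :
    ∫ x : Set.Icc (0:ℝ) 1, rad m x * rad n x = if m = n then 1 else 0 := by
  rw [integral_subtype measurableSet_Icc (fun x => rad m x * rad n x), integral_Icc_eq_integral_Ioc,
    ← intervalIntegral.integral_of_le zero_le_one]
  rcases lt_trichotomy m n with h | h | h
  · rw [rad_orth_lt h, if_neg h.ne]
  · subst h
    have : ∀ x, rad m x * rad m x = 1 := by
      intro x; rcases rad_eq m x with h | h <;> simp [h]
    simp [this]
  · simp_rw [mul_comm (rad m _)]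
    rw [rad_orth_lt h, if_neg h.ne']

/-- the space -/
noncomputable abbrev XX := Lp ℝ 1 (volume : Measure (Set.Icc (0:ℝ) 1))

lemma rad_mul_int (n : ℕ) (f : XX) : Integrable (fun x : Set.Icc (0:ℝ) 1 => rad n x * f x) := by
  refine (L1.integrable_coeFn f).bdd_mul (c := 1)
    ((rad_meas n).comp measurable_subtype_coe).aestronglyMeasurable ?_
  filter_upwards with x
  rcases rad_eq n x with h | h <;> simp [h]

/-- multiplication by rad -/
noncomputable def MM (n : ℕ) (f : XX) : XX := (rad_mul_int n f).toL1 _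

lemma MM_coe (n : ℕ) (f : XX) : ∀ᵐ x : Set.Icc (0:ℝ) 1, MM n f x = rad n x * f x :=
  (rad_mul_int n f).coeFn_toL1

lemma sum_coe (f : ℕ → XX) (N : ℕ) :
    ∀ᵐ x : Set.Icc (0:ℝ) 1, (∑ n ∈ Finset.range N, f n : XX) x = ∑ n ∈ Finset.range N, f n x := by
  induction N with
  | zero => simp
  | succ N ih =>
    rw [Finset.sum_range_succ]
    filter_upwards [ih, Lp.coeFn_add (∑ n ∈ Finset.range N, f n : XX) (f N)] with x h1 h2
    rw [h2, Pi.add_apply, h1, Finset.sum_range_succ]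

lemma MM_weak (f : XX) (C : ℝ) (hC : ∀ᵐ x : Set.Icc (0:ℝ) 1, |f x| ≤ C) (b : XX →L[ℝ] ℝ) :
    Tendsto (fun n => b (MM n f)) atTop (𝓝 0) := by
  set c : ℕ → ℝ := fun n => b (MM n f) with hc
  set K : ℝ := ‖b‖ * C with hK
  have hC0 : 0 ≤ C := by
    obtain ⟨x, hx⟩ := hC.exists
    exact (abs_nonneg _).trans hx
  have key : ∀ N, ∑ n ∈ Finset.range N, c n ^ 2 ≤ K ^ 2 := by
    intro N
    set Q := ∑ n ∈ Finset.range N, c n ^ 2 with hQ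
    set v : XX := ∑ n ∈ Finset.range N, c n • MM n f with hv
    have hbv : b v = Q := by
      rw [hv, map_sum]
      exact Finset.sum_congr rfl fun n _ => by rw [map_smul, smul_eq_mul, sq]
    set φ : Set.Icc (0:ℝ) 1 → ℝ := fun x => ∑ n ∈ Finset.range N, c n * rad n x with hφ
    have hvφ : ∀ᵐ x : Set.Icc (0:ℝ) 1, v x = φ x * f x := by
      have h1 : ∀ᵐ x : Set.Icc (0:ℝ) 1, ∀ n, (c n • MM n f : XX) x = c n * (rad n x * f x) := by
        rw [ae_all_iff]; intro n
        filter_upwards [Lp.coeFn_smul (c n) (MM n f), MM_coe n f] with x h1 h2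
        rw [h1, Pi.smul_apply, h2, smul_eq_mul]
      filter_upwards [sum_coe (fun n => c n • MM n f) N, h1] with x h2 h3
      rw [hv, h2, hφ, Finset.sum_mul]
      exact Finset.sum_congr rfl fun n _ => by rw [h3]; ring
    have hrr : ∀ i j : ℕ, Integrable (fun x : Set.Icc (0:ℝ) 1 => rad i x * rad j x) := by
      intro i j
      refine Integrable.of_bound (C := 1)
        (((rad_meas i).mul (rad_meas j)).comp measurable_subtype_coe).aestronglyMeasurable ?_
      filter_upwards with x
      rcases rad_eq i x with h | h <;> rcases rad_eq j x with h' | h' <;> simp [h, h']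
    have hsq : ∀ x, φ x ^ 2 = ∑ i ∈ Finset.range N, ∑ j ∈ Finset.range N,
        c i * c j * (rad i x * rad j x) := by
      intro x
      rw [sq, hφ, Finset.sum_mul_sum]
      exact Finset.sum_congr rfl fun i _ => Finset.sum_congr rfl fun j _ => by ring
    have hint : Integrable (fun x => φ x ^ 2) := by
      simp_rw [hsq]
      exact integrable_finsetSum _ fun i _ => integrable_finsetSum _ fun j _ =>
        (hrr i j).const_mul _
    have hφ2 : ∫ x, φ x ^ 2 = Q := by
      simp_rw [hsq]
      rw [integral_finsetSum _ fun i _ => integrable_finsetSum _ fun j _ =>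
        (hrr i j).const_mul _]
      rw [hQ]
      refine Finset.sum_congr rfl fun i hi => ?_
      rw [integral_finsetSum _ fun j _ => (hrr i j).const_mul _]
      simp_rw [integral_const_mul, rad_orth]
      simp [Finset.mem_range.1 hi, sq]
    have hnv : ‖b‖ * ‖v‖ ≤ K ^ 2 / 2 + Q / 2 := by
      rw [L1.norm_eq_integral_norm, ← integral_const_mul, ← hφ2]
      have : ∫ x : Set.Icc (0:ℝ) 1, (K ^ 2 / 2 + φ x ^ 2 / 2) = K^2/2 + (∫ x, φ x ^ 2)/2 := by
        rw [integral_add (integrable_const _) (hint.div_const 2)]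
        have h2 := integral_div (μ := (volume : Measure (Set.Icc (0:ℝ) 1))) 2 (fun x => φ x ^ 2)
        rw [h2]; simp
      rw [← this]
      refine integral_mono_ae ((L1.integrable_coeFn v).norm.const_mul _)
        ((integrable_const _).add (hint.div_const 2)) ?_
      filter_upwards [hvφ, hC] with x h1 h2
      simp only [h1, norm_mul, Real.norm_eq_abs]
      have : ‖b‖ * (|φ x| * |f x|) ≤ K * |φ x| := by
        rw [hK]
        have := mul_le_mul_of_nonneg_left h2 (mul_nonneg (norm_nonneg b) (abs_nonneg (φ x)))
        linarith
      nlinarith [sq_nonneg (K - |φ x|), sq_abs (φ x)]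
    have := (le_abs_self _).trans (b.le_opNorm v)
    rw [hbv] at this
    linarith
  have hs : Summable (fun n => c n ^ 2) :=
    summable_of_sum_range_le (fun n => sq_nonneg _) key
  have h0 := hs.tendsto_atTop_zero
  have h1 := h0.sqrt
  simp only [Real.sqrt_sq_eq_abs, Real.sqrt_zero] at h1
  exact (tendsto_zero_iff_abs_tendsto_zero _).2 h1

/-- truncated besselian sum -/
noncomputable def BB (a : ℕ → XX) (b : ℕ → XX →L[ℝ] ℝ) (N : ℕ) (x : XX) (y : XX →L[ℝ] ℝ) : ℝ :=
  ∑ j ∈ Finset.range N, |b j x| * |y (a j)|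

lemma BB_add (a : ℕ → XX) (b : ℕ → XX →L[ℝ] ℝ) (N N' : ℕ) (h : N ≤ N') (x : XX)
    (y : XX →L[ℝ] ℝ) :
    |y (∑ j ∈ Finset.range N', b j x • a j - ∑ j ∈ Finset.range N, b j x • a j)|
      ≤ BB a b N' x y - BB a b N x y := by
  unfold BB
  rw [← Finset.sum_Ico_eq_sub _ h, ← Finset.sum_Ico_eq_sub _ h, map_sum]
  refine (Finset.abs_sum_le_sum_abs _ _).trans (le_of_eq ?_)
  exact Finset.sum_congr rfl fun j _ => by rw [map_smul, smul_eq_mul, abs_mul]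

lemma abs_le_eta {y : XX →L[ℝ] ℝ} {z : XX} {η : ℝ} (h : ‖z‖ ≤ η) : |y z| ≤ η * ‖y‖ := by
  have h1 := y.le_opNorm z
  rw [Real.norm_eq_abs] at h1
  nlinarith [norm_nonneg y]

lemma norm_nonneg_fun (f : XX) (h : ∀ᵐ x : Set.Icc (0:ℝ) 1, 0 ≤ f x) : ‖f‖ = ∫ x, f x := by
  rw [L1.norm_eq_integral_norm]
  refine integral_congr_ae ?_
  filter_upwards [h] with x hx
  rw [Real.norm_eq_abs, abs_of_nonneg hx]

lemma state_exists (a : ℕ → XX) (b : ℕ → XX →L[ℝ] ℝ) (hS : IsSchauderFrame a b) (k : ℕ) :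
    ∀ δ > (0:ℝ), ∃ (f h : XX) (N : ℕ),
      (∀ᵐ x : Set.Icc (0:ℝ) 1, 0 ≤ f x ∧ (f x = 0 ∨ h x = 0)) ∧
      (∃ C : ℝ, ∀ᵐ x : Set.Icc (0:ℝ) 1, |f x| ≤ C) ∧
      ‖∑ j ∈ Finset.range N, b j f • a j - f‖ ≤ δ ∧
      (∀ y : XX →L[ℝ] ℝ, |y (h - (1/3:ℝ) • f)| ≤ BB a b N f y + δ * ‖y‖) ∧
      |‖f‖ - 1| ≤ δ ∧ (2/3) * (k:ℝ) - δ ≤ ‖h‖ := by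
  have lim : ∀ (x : XX) (δ : ℝ), 0 < δ → ∀ N₀ : ℕ, ∃ N, N₀ ≤ N ∧
      ‖∑ j ∈ Finset.range N, b j x • a j - x‖ ≤ δ := by
    intro x δ hδ N₀
    obtain ⟨N₁, hN₁⟩ := Metric.tendsto_atTop.1 (hS x) δ hδ
    refine ⟨max N₀ N₁, le_max_left _ _, ?_⟩
    have := hN₁ _ (le_max_right N₀ N₁)
    rw [dist_eq_norm] at this
    exact this.le
  induction k with
  | zero =>
    intro δ hδ
    have h1i : Integrable (fun _ : Set.Icc (0:ℝ) 1 => (1:ℝ)) := integrable_const 1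
    set f : XX := h1i.toL1 _ with hf
    have hfx : ∀ᵐ x : Set.Icc (0:ℝ) 1, f x = 1 := h1i.coeFn_toL1
    obtain ⟨N, -, hN⟩ := lim f δ hδ 0
    refine ⟨f, 0, N, ?_, ⟨1, ?_⟩, hN, ?_, ?_, ?_⟩
    · filter_upwards [hfx, Lp.coeFn_zero ℝ 1 (volume : Measure (Set.Icc (0:ℝ) 1))] with x h1 h2
      rw [h1, h2]; simp
    · filter_upwards [hfx] with x h1
      simp [h1]
    · intro y
      have h1 := BB_add a b 0 N (Nat.zero_le _) f y
      have h2 := abs_le_eta (y := y) hN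
      simp only [Finset.range_zero, Finset.sum_empty, sub_zero, BB] at h1
      rw [map_sub] at h2
      simp only [BB, zero_sub, map_neg, abs_neg, map_smul, smul_eq_mul, abs_mul]
      have h3 := abs_sub_abs_le_abs_sub (y f) (y (∑ j ∈ Finset.range N, b j f • a j))
      rw [abs_sub_comm] at h3
      have := abs_nonneg (y f)
      norm_num [abs_of_pos]
      linarith
    · have : ‖f‖ = 1 := by
        rw [norm_nonneg_fun f (by filter_upwards [hfx] with x h1; simp [h1]), integral_congr_ae hfx]
        simp
      rw [this]; simpa using hδ.le
    · simp; linarith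
  | succ k ih =>
    intro δ hδ
    set η := δ / 5 with hη
    have hη0 : 0 < η := by positivity
    obtain ⟨f, h, N, hae, ⟨C, hC⟩, hSN, hy, hn, hh⟩ := ih η hη0
    -- choose n
    have t1 : Tendsto (fun n => ∑ j ∈ Finset.range N, |b j (MM n f)| * ‖a j‖) atTop (𝓝 0) := by
      have : Tendsto (fun n => ∑ j ∈ Finset.range N, |b j (MM n f)| * ‖a j‖) atTop
          (𝓝 (∑ j ∈ Finset.range N, |(0:ℝ)| * ‖a j‖)) :=
        tendsto_finsetSum _ fun j _ => ((MM_weak f C hC (b j)).abs).mul_const _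
      simpa using this
    have t2 : Tendsto (fun n => ∫ x, MM n f x) atTop (𝓝 0) := by
      have := MM_weak f C hC (L1.integralCLM)
      refine this.congr fun n => ?_
      rw [← L1.integral_eq, L1.integral_eq_integral]
    obtain ⟨n, hn1, hn2⟩ := ((t1.eventually (gt_mem_nhds hη0)).and
      (t2.abs.eventually (gt_mem_nhds (by simpa using hη0)))).exists
    set u := MM n f with hu
    have hux : ∀ᵐ x : Set.Icc (0:ℝ) 1, u x = f x ∨ u x = - f x := by
      filter_upwards [MM_coe n f] with x hx
      rw [hu, hx]
      rcases rad_eq n x with h | h <;> simp [h]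
    obtain ⟨N', hNN, hN'⟩ := lim (f + u) η hη0 N
    have hf'x := Lp.coeFn_add f u
    have hf'0 : ∀ᵐ x : Set.Icc (0:ℝ) 1, 0 ≤ (f + u) x := by
      filter_upwards [hux, hf'x, hae] with x h1 h2 h3
      rw [h2, Pi.add_apply]
      rcases h1 with h1 | h1 <;> rw [h1] <;> linarith [h3.1]
    have hh'x : ∀ᵐ x : Set.Icc (0:ℝ) 1, ((2/3:ℝ) • (f - u) - h) x = (2/3) * (f x - u x) - h x := by
      filter_upwards [Lp.coeFn_sub ((2/3:ℝ) • (f - u)) h, Lp.coeFn_smul (2/3:ℝ) (f - u),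
        Lp.coeFn_sub f u] with x h1 h2 h3
      rw [h1, Pi.sub_apply, h2, Pi.smul_apply, h3, Pi.sub_apply, smul_eq_mul]
    have hfn := norm_nonneg_fun f (hae.mono fun x hx => hx.1)
    have hfi := L1.integrable_coeFn f
    have hui := L1.integrable_coeFn u
    have hhi := L1.integrable_coeFn h
    have hf'n : ‖f + u‖ = ‖f‖ + ∫ x, u x := by
      rw [norm_nonneg_fun _ hf'0, hfn, integral_congr_ae hf'x, ← integral_add hfi hui]
      rfl
    have hfui : Integrable (fun x => (2/3:ℝ) * (f x - u x)) := (hfi.sub hui).const_mul _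
    have hh'n : ‖(2/3:ℝ) • (f - u) - h‖ = (2/3) * (‖f‖ - ∫ x, u x) + ‖h‖ := by
      rw [L1.norm_eq_integral_norm, L1.norm_eq_integral_norm h, hfn, ← integral_sub hfi hui,
        ← integral_const_mul, ← integral_add hfui hhi.norm]
      refine integral_congr_ae ?_
      filter_upwards [hux, hh'x, hae] with x h1 h2 h3
      simp only [h2, Real.norm_eq_abs]
      rcases h3.2 with h4 | h4
      · have : u x = 0 := by rcases h1 with h1 | h1 <;> simp [h1, h4]
        simp [h4, this]
      · rw [h4, sub_zero, abs_zero, add_zero, abs_of_nonneg]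
        rcases h1 with h1 | h1 <;> rw [h1] <;> linarith [h3.1]
    rw [abs_lt] at hn2
    rw [abs_le] at hn
    refine ⟨f + u, (2/3:ℝ) • (f - u) - h, N', ?_, ⟨2 * C, ?_⟩, ?_, ?_, ?_, ?_⟩
    · filter_upwards [hux, hf'x, hh'x, hae, hf'0] with x h1 h2 h3 h4 h5
      refine ⟨h5, ?_⟩
      rw [h2, h3, Pi.add_apply]
      rcases h1 with h1 | h1
      · rcases h4.2 with h6 | h6
        · left; rw [h1, h6]; simp
        · right; rw [h1, h6]; simp
      · left; rw [h1]; simp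
    · filter_upwards [hux, hf'x, hC] with x h1 h2 h3
      rw [h2, Pi.add_apply]
      refine (abs_add_le _ _).trans ?_
      rcases h1 with h1 | h1 <;> rw [h1] <;> (try rw [abs_neg]) <;> linarith
    · linarith
    · intro y
      have e0 : y ((2/3:ℝ) • (f - u) - h - (1/3:ℝ) • (f + u))
          = - (y (h - (1/3:ℝ) • f) + y u) := by
        simp only [map_sub, map_smul, map_add, smul_eq_mul]; ring
      have e1 : |y ((2/3:ℝ) • (f - u) - h - (1/3:ℝ) • (f + u))|
          ≤ |y (h - (1/3:ℝ) • f)| + |y u| := by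
        rw [e0, abs_neg]; exact abs_add_le _ _
      have e2 := hy y
      have e3 : ∑ j ∈ Finset.range N, |b j u| * |y (a j)| ≤ η * ‖y‖ := by
        calc ∑ j ∈ Finset.range N, |b j u| * |y (a j)|
            ≤ ∑ j ∈ Finset.range N, |b j u| * ‖a j‖ * ‖y‖ := by
              refine Finset.sum_le_sum fun j _ => ?_
              rw [mul_assoc]
              exact mul_le_mul_of_nonneg_left (abs_le_eta le_rfl) (abs_nonneg _)
          _ = (∑ j ∈ Finset.range N, |b j u| * ‖a j‖) * ‖y‖ := by rw [Finset.sum_mul]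
          _ ≤ η * ‖y‖ := mul_le_mul_of_nonneg_right hn1.le (norm_nonneg _)
      have e4 : BB a b N f y ≤ BB a b N (f + u) y + η * ‖y‖ := by
        refine le_trans ?_ (add_le_add_right e3 _)
        unfold BB
        rw [← Finset.sum_add_distrib]
        refine Finset.sum_le_sum fun j _ => ?_
        rw [← add_mul]
        refine mul_le_mul_of_nonneg_right ?_ (abs_nonneg _)
        have : b j f = b j (f + u) - b j u := by rw [map_add]; ring
        rw [this]; exact abs_sub _ _
      have e5 := BB_add a b N N' hNN (f + u) y
      have e6 := abs_le_eta (y := y) hN'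
      have e7 := abs_le_eta (y := y) hSN
      have e8 : |y (∑ j ∈ Finset.range N, b j u • a j)| ≤ η * ‖y‖ := by
        refine le_trans ?_ e3
        rw [map_sum]
        refine (Finset.abs_sum_le_sum_abs _ _).trans (le_of_eq ?_)
        exact Finset.sum_congr rfl fun j _ => by rw [map_smul, smul_eq_mul, abs_mul]
      have e9 : y (∑ j ∈ Finset.range N, b j (f + u) • a j)
          = y (∑ j ∈ Finset.range N, b j f • a j) + y (∑ j ∈ Finset.range N, b j u • a j) := by
        rw [← map_add, ← Finset.sum_add_distrib]
        simp only [map_add, add_smul]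
      rw [map_sub] at e5 e6 e7
      rw [e9] at e5
      rw [map_add] at e6
      have e10 : |y u| ≤ (BB a b N' (f + u) y - BB a b N (f + u) y) + 3 * (η * ‖y‖) := by
        rw [abs_le] at e5 e6 e7 e8 ⊢
        constructor <;> linarith [e5.1, e5.2, e6.1, e6.2, e7.1, e7.2, e8.1, e8.2]
      have : δ = 5 * η := by rw [hη]; ring
      rw [this]; linarith
    · rw [hf'n, abs_le]; constructor <;> linarith [hn.1, hn.2, hn2.1, hn2.2]
    · rw [hh'n]; push_cast; linarith [hn.1, hn.2, hn2.1, hn2.2]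

/-- The real Banach space `L¹([0,1])` has no besselian Schauder frame. -/
theorem L1_has_no_besselianSchauderFrame :
    ¬ ∃ (a : ℕ → Lp ℝ 1 (volume : Measure (Set.Icc (0:ℝ) 1)))
        (b : ℕ → Lp ℝ 1 (volume : Measure (Set.Icc (0:ℝ) 1)) →L[ℝ] ℝ),
      IsBesselianSchauderFrame a b := by
  rintro ⟨a, b, hS, A, hA, hB⟩
  obtain ⟨k, hk⟩ := exists_nat_gt (3 * A + 10)
  obtain ⟨f, h, N, -, -, -, hy, hn, hh⟩ := state_exists a b hS k 1 one_pos
  obtain ⟨y, hy1, hy2⟩ := exists_dual_vector'' ℝ (h - (1/3:ℝ) • f)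
  have h1 := hy y
  have hy3 : y (h - (1/3:ℝ) • f) = ‖h - (1/3:ℝ) • f‖ := hy2
  rw [hy3, abs_of_nonneg (norm_nonneg _)] at h1
  have h2 : BB a b N f y ≤ A * ‖f‖ * ‖y‖ :=
    ((hB f y).1.sum_le_tsum _ fun j _ => by positivity).trans (hB f y).2
  have h3 := norm_sub_norm_le h ((1/3:ℝ) • f)
  rw [norm_smul] at h3
  norm_num at h3
  rw [abs_le] at hn
  have h4 : A * ‖f‖ * ‖y‖ ≤ A * 2 * 1 := by
    gcongr
    linarith [hn.2]
  linarith [hn.2]
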